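/- (Siegel) Let p be a prime and let α be an integer with α > 1 + 2·ν_p(2N_γ n), where ν_p denotes the p-adic valuation and N_γ is the order of γ + ℤ^m in L'/ℤ^m (note 2N_γ n ∈ ℤ, and assume n ≠ 0). Then N_{γ,n}(p^{α+1}) = p^{m−1} · N_{γ,n}(p^{α}). -/

import Mathlib

open Finset Matrix

namespace EisensteinWeil

variable {m : ℕ}

/-- The bilinear form `(x,y) = xᵀ S y` on `ℚ^m`. -/
def bil (S : Matrix (Fin m) (Fin m) ℤ) (x y : Fin m → ℚ) : ℚ :=
  x ⬝ᵥ (S.map (Int.cast : ℤ → ℚ)).mulVec y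

/-- The quadratic form `Q(x) = (x,x)/2`. -/
def Qf (S : Matrix (Fin m) (Fin m) ℤ) (x : Fin m → ℚ) : ℚ := bil S x x / 2

/-- Membership in the dual lattice `L' = S⁻¹ℤ^m`: `x ∈ L'` iff `(x,r) ∈ ℤ` for all `r ∈ ℤ^m`. -/
def memDual (S : Matrix (Fin m) (Fin m) ℤ) (γ : Fin m → ℚ) : Prop :=
  ∀ r : Fin m → ℤ, ∃ z : ℤ, bil S γ (fun i => (r i : ℚ)) = z

/-- `N` is the order of `γ + ℤ^m` in `L'/ℤ^m`, i.e. the smallest positive integer with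
`N • γ ∈ ℤ^m`. -/
def isOrderOf (γ : Fin m → ℚ) (N : ℕ) : Prop :=
  0 < N ∧ (∀ i, ∃ z : ℤ, (N : ℚ) * γ i = z) ∧
    ∀ k : ℕ, 0 < k → (∀ i, ∃ z : ℤ, (k : ℚ) * γ i = z) → N ≤ k

/-- The representation number `N_{γ,n}(a)`, counting `r ∈ (ℤ^m)/(aℤ^m)`
(represented by `r : Fin m → Fin a`) with `Q(r − γ) + n ≡ 0 (mod a)`. -/
noncomputable def repNum (S : Matrix (Fin m) (Fin m) ℤ) (γ : Fin m → ℚ) (n : ℚ) (a : ℕ) : ℕ :=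
  Nat.card {r : Fin m → Fin a //
    ∃ t : ℤ, Qf S ((fun i => ((r i : ℕ) : ℚ)) - γ) + n = (a : ℚ) * t}

/-- `e(x) = e^{2πix}`. -/
noncomputable def eQ (x : ℚ) : ℂ := Complex.exp (2 * Real.pi * Complex.I * (x : ℂ))

/-- A canonical choice of inverse of `d` modulo `c`. -/
def adInv (c d : ℕ) : ℕ := ((d : ZMod c)⁻¹).val

/-- The sum `G_{γ,n}(c; β, χ)`. -/
noncomputable def Gsum (S : Matrix (Fin m) (Fin m) ℤ) (γ : Fin m → ℚ) (n : ℚ)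
    (β : Fin m → ℚ) (Nβ : ℕ) (χ : DirichletCharacter ℂ Nβ) (c : ℕ) : ℂ :=
  ∑ ν ∈ (range Nβ).filter (fun ν => Nat.Coprime ν Nβ), χ (ν : ZMod Nβ) *
    ∑ d ∈ (range c).filter (fun d => Nat.Coprime d c),
      ∑ r ∈ Fintype.piFinset (fun _ : Fin m => range c),
        eQ (((adInv c d : ℚ) * Qf S (ν • β + fun i => (r i : ℚ))
            - bil S γ (ν • β + fun i => (r i : ℚ))
            + (d : ℚ) * (Qf S γ + n)) / c)

/-- The Gauss sum `G(χ) = ∑_{u mod N, gcd(u,N)=1} χ(u) e(u/N)`. -/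
noncomputable def gaussS (N : ℕ) (χ : DirichletCharacter ℂ N) : ℂ :=
  ∑ u ∈ (range N).filter (fun u => Nat.Coprime u N), χ (u : ZMod N) * eQ (u / N)


/-- The number of classes `r ∈ (ℤ/a)^m` whose standard representative satisfies `P`. -/
noncomputable def classCount (m a : ℕ) (P : (Fin m → ℤ) → Prop) : ℕ :=
  Nat.card {r : Fin m → Fin a // P fun i => ((r i : ℕ) : ℤ)}

lemma classCount_le {a : ℕ} (ha : 0 < a) {P P' : (Fin m → ℤ) → Prop}
    (hP' : ∀ r r' : Fin m → ℤ, (∀ i, (a : ℤ) ∣ r' i - r i) → P' r → P' r')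
    (T : (Fin m → ℤ) → Fin m → ℤ) (hT : ∀ r, P r → P' (T r))
    (hinj : ∀ r r', (∀ i, (a : ℤ) ∣ T r' i - T r i) → ∀ i, (a : ℤ) ∣ r' i - r i) :
    classCount m a P ≤ classCount m a P' := by
  have ha' : (a : ℤ) ≠ 0 := by exact_mod_cast ha.ne'
  have hnn : ∀ z : ℤ, ((z % a).toNat : ℤ) = z % a := fun z =>
    Int.toNat_of_nonneg (Int.emod_nonneg _ ha')
  have hlt : ∀ z : ℤ, (z % a).toNat < a := fun z => by
    have := Int.emod_lt_of_pos z (by exact_mod_cast ha : (0 : ℤ) < a)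
    have := hnn z
    omega
  unfold classCount
  refine Nat.card_le_card_of_injective
    (fun x => ⟨fun i => ⟨(T (fun i => ((x.1 i : ℕ) : ℤ)) i % a).toNat, hlt _⟩, ?_⟩) ?_
  · refine hP' _ _ (fun i => ?_) (hT _ x.2)
    simp only [hnn]
    exact Int.dvd_emod_sub_self
  · intro x y hxy
    apply Subtype.ext
    funext i
    have hcong : ∀ i, (a : ℤ) ∣
        T (fun i => ((y.1 i : ℕ) : ℤ)) i - T (fun i => ((x.1 i : ℕ) : ℤ)) i := fun i => by
      have h := congrArg Fin.val (congrFun (congrArg Subtype.val hxy) i)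
      simp only at h
      have h' : ((T (fun i => ((x.1 i : ℕ) : ℤ)) i % a).toNat : ℤ) =
        (T (fun i => ((y.1 i : ℕ) : ℤ)) i % a).toNat := by rw [h]
      rw [hnn, hnn] at h'
      exact Int.ModEq.dvd h'
    have h := (Int.modEq_iff_dvd.2 (hinj _ _ hcong i))
    have h2 := Nat.ModEq.eq_of_lt_of_lt (Int.natCast_modEq_iff.1 h) (x.1 i).2 (y.1 i).2
    exact Fin.ext h2

lemma classCount_mul {a b : ℕ} {P : (Fin m → ℤ) → Prop}
    (hP : ∀ r r' : Fin m → ℤ, (∀ i, (a : ℤ) ∣ r' i - r i) → P r → P r') :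
    classCount m (b * a) P = b ^ m * classCount m a P := by
  have e : {r : Fin m → Fin (b * a) // P fun i => ((r i : ℕ) : ℤ)} ≃
      (Fin m → Fin b) × {r : Fin m → Fin a // P fun i => ((r i : ℕ) : ℤ)} := by
    refine Equiv.trans (Equiv.subtypeEquiv
      (q := fun s : (Fin m → Fin b) × (Fin m → Fin a) => P fun i => ((s.2 i : ℕ) : ℤ))
      ((Equiv.arrowCongr (Equiv.refl _) finProdFinEquiv.symm).trans
        (Equiv.arrowProdEquivProdArrow _ _ _)) ?_) ?_
    · intro r
      have key : ∀ i, (a : ℤ) ∣ ((r i : ℕ) : ℤ) - (((finProdFinEquiv.symm (r i)).2 : ℕ) : ℤ) :=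
        fun i => by
          have h : ((finProdFinEquiv.symm (r i)).2 : ℕ) = (r i : ℕ) % a := rfl
          rw [h]
          push_cast
          exact Int.dvd_self_sub_emod
      refine ⟨hP _ _ fun i => ?_, hP _ _ fun i => ?_⟩
      · have := key i
        rw [← dvd_neg, neg_sub] at this
        exact this
      · exact key i
    · exact {
        toFun := fun s => (s.1.1, ⟨s.1.2, s.2⟩)
        invFun := fun s => ⟨(s.1, s.2.1), s.2.2⟩
        left_inv := fun _ => rfl
        right_inv := fun _ => rfl }
  unfold classCount
  rw [Nat.card_congr e, Nat.card_prod]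
  simp

lemma classCount_eq_sum {a k : ℕ} {P : (Fin m → ℤ) → Prop} {A : ℕ → (Fin m → ℤ) → Prop}
    (h : ∀ r, P r ↔ ∃ j < k, A j r)
    (huniq : ∀ r, ∀ j < k, ∀ j' < k, A j r → A j' r → j = j') :
    classCount m a P = ∑ j ∈ range k, classCount m a (A j) := by
  classical
  have hA : ∀ P : (Fin m → ℤ) → Prop, classCount m a P =
      #{r : Fin m → Fin a | P fun i => ((r i : ℕ) : ℤ)} := fun P => by
    rw [classCount, Nat.card_eq_fintype_card, Fintype.card_subtype]
  simp only [hA]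
  rw [← Finset.card_biUnion]
  · congr 1
    ext r
    simp only [mem_filter, mem_univ, true_and, mem_biUnion, mem_range, h]
  · intro j hj j' hj' hne
    refine Finset.disjoint_left.2 fun r hr hr' => hne ?_
    exact huniq _ j (by simpa using hj) j' (by simpa using hj') (by simpa using hr)
      (by simpa using hr')

lemma exists_dvd_mul_sub_pow {p : ℕ} (hp : p.Prime) {ν : ℕ} {x : ℤ}
    (hx : ¬ (p : ℤ) ^ (ν + 1) ∣ x) : ∃ c : ℤ, (p : ℤ) ^ (ν + 1) ∣ c * x - (p : ℤ) ^ ν := by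
  have hg : Int.gcd x ((p : ℤ) ^ (ν + 1)) ∣ p ^ (ν + 1) := by
    have := Int.gcd_dvd_right x ((p : ℤ) ^ (ν + 1))
    exact_mod_cast this
  obtain ⟨k, hk, hk'⟩ := (Nat.dvd_prime_pow hp).1 hg
  have hkν : k ≤ ν := by
    by_contra hlt
    have : k = ν + 1 := by omega
    subst this
    apply hx
    have := Int.gcd_dvd_left x ((p : ℤ) ^ (ν + 1))
    rw [hk'] at this
    exact_mod_cast this
  have hb := Int.gcd_eq_gcd_ab x ((p : ℤ) ^ (ν + 1))
  rw [hk'] at hb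
  push_cast at hb
  refine ⟨(p : ℤ) ^ (ν - k) * Int.gcdA x ((p : ℤ) ^ (ν + 1)),
    -((p : ℤ) ^ (ν - k) * Int.gcdB x ((p : ℤ) ^ (ν + 1))), ?_⟩
  have hpow : (p : ℤ) ^ ν = (p : ℤ) ^ (ν - k) * (p : ℤ) ^ k := by
    rw [← pow_add, Nat.sub_add_cancel hkν]
  rw [hpow, hb]
  ring

lemma exists_dvd_dotProduct_sub_pow {p : ℕ} (hp : p.Prime) {ν : ℕ} {u : Fin m → ℤ}
    (hu : ¬ ∀ i, (p : ℤ) ^ (ν + 1) ∣ u i) :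
    ∃ h : Fin m → ℤ, (p : ℤ) ^ (ν + 1) ∣ h ⬝ᵥ u - (p : ℤ) ^ ν := by
  push Not at hu
  obtain ⟨i, hi⟩ := hu
  obtain ⟨c, hc⟩ := exists_dvd_mul_sub_pow hp hi
  exact ⟨Pi.single i c, by simpa using hc⟩

/-- Hensel-type equidistribution: if `f` is quadratic with gradient `g`, and `g` does not vanish
modulo `p ^ (ν + 1)` where `p ^ α ∣ f`, then `f / p ^ α` is equidistributed modulo `p`. -/
lemma classCount_dvd_mul_prime {p : ℕ} (hp : p.Prime) {ν α : ℕ} (hα : 2 * ν < α)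
    {f q : (Fin m → ℤ) → ℤ} {g : (Fin m → ℤ) → Fin m → ℤ} {S : Matrix (Fin m) (Fin m) ℤ}
    (hf : ∀ r h, f (r + h) = f r + h ⬝ᵥ g r + q h)
    (hq : ∀ (c : ℤ) h, q (c • h) = c ^ 2 * q h)
    (hg : ∀ r h, g (r + h) = g r + S.mulVec h)
    (hnd : ∀ r, (p : ℤ) ^ α ∣ f r → ¬ ∀ i, (p : ℤ) ^ (ν + 1) ∣ g r i)
    (hper : ∀ (a : ℤ) (r r' : Fin m → ℤ), (∀ i, a ∣ r' i - r i) → a ∣ f r' - f r) :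
    p * classCount m (p ^ (α + 1)) (fun r => (p : ℤ) ^ (α + 1) ∣ f r) =
      classCount m (p ^ (α + 1)) (fun r => (p : ℤ) ^ α ∣ f r) := by
  choose! H hH using fun u : Fin m → ℤ => exists_dvd_dotProduct_sub_pow (u := u) (ν := ν) hp
  set red : (Fin m → ℤ) → Fin m → ℤ := fun r i => g r i % (p : ℤ) ^ (ν + 1) with hred
  set T : (Fin m → ℤ) → Fin m → ℤ := fun r => r + (p : ℤ) ^ (α - ν) • H (red r) with hTdef
  have hredcongr : ∀ r r' : Fin m → ℤ, (∀ i, (p : ℤ) ^ (α - ν) ∣ r' i - r i) →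
      red r' = red r := by
    intro r r' h
    choose d hd using h
    have : r' = r + (p : ℤ) ^ (α - ν) • d := by
      funext i
      simp [← hd i]
    funext i
    refine ((Int.modEq_iff_dvd).2 ?_).symm
    rw [this, hg, mulVec_smul]
    simp only [Pi.add_apply, Pi.smul_apply, add_sub_cancel_left, smul_eq_mul]
    exact Dvd.dvd.mul_right (pow_dvd_pow _ (by omega)) _
  have hredT : ∀ r, red (T r) = red r := fun r =>
    hredcongr _ _ fun i => by simp [hTdef]
  have hfT : ∀ r, (p : ℤ) ^ α ∣ f r → (p : ℤ) ^ (α + 1) ∣ f (T r) - (f r + (p : ℤ) ^ α) := by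
    intro r hr
    have h1 : (p : ℤ) ^ (ν + 1) ∣ H (red r) ⬝ᵥ red r - (p : ℤ) ^ ν := by
      refine hH _ fun hall => hnd r hr fun i => ?_
      exact (Int.dvd_iff_emod_eq_zero).2 (by
        have := (Int.dvd_iff_emod_eq_zero).1 (hall i)
        simpa [hred] using this)
    have h2 : (p : ℤ) ^ (ν + 1) ∣ H (red r) ⬝ᵥ g r - H (red r) ⬝ᵥ red r := by
      rw [← dotProduct_sub]
      exact Finset.dvd_sum fun i _ => Dvd.dvd.mul_left Int.dvd_self_sub_emod _
    have h3 := dvd_add h2 h1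
    rw [sub_add_sub_cancel] at h3
    have h4 := mul_dvd_mul_left ((p : ℤ) ^ (α - ν)) h3
    rw [← pow_add, mul_sub, ← pow_add, show α - ν + (ν + 1) = α + 1 by omega,
      show α - ν + ν = α by omega] at h4
    have h5 : (p : ℤ) ^ (α + 1) ∣ ((p : ℤ) ^ (α - ν)) ^ 2 * q (H (red r)) := by
      rw [← pow_mul]
      exact Dvd.dvd.mul_right (pow_dvd_pow _ (by omega)) _
    have h6 : f (T r) - (f r + (p : ℤ) ^ α) =
        ((p : ℤ) ^ (α - ν) * H (red r) ⬝ᵥ g r - (p : ℤ) ^ α) +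
          ((p : ℤ) ^ (α - ν)) ^ 2 * q (H (red r)) := by
      rw [hTdef]
      simp only
      rw [hf, hq, smul_dotProduct, smul_eq_mul]
      ring
    rw [h6]
    exact dvd_add h4 h5
  have hinj : ∀ r r', (∀ i, ((p ^ (α + 1) : ℕ) : ℤ) ∣ T r' i - T r i) →
      ∀ i, ((p ^ (α + 1) : ℕ) : ℤ) ∣ r' i - r i := by
    intro r r' h
    have h1 : red r' = red r := by
      rw [← hredT r, ← hredT r']
      refine hredcongr _ _ fun i => ?_
      refine dvd_trans ?_ (h i)
      push_cast
      exact pow_dvd_pow _ (by omega)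
    intro i
    simpa [hTdef, h1] using h i
  set A : ℕ → (Fin m → ℤ) → Prop := fun j r => (p : ℤ) ^ (α + 1) ∣ f r - j * (p : ℤ) ^ α with hA
  have hAX : ∀ j r, A j r → (p : ℤ) ^ α ∣ f r := fun j r h =>
    (dvd_sub_left (Dvd.intro_left _ rfl)).1 ((pow_dvd_pow _ (Nat.le_succ _)).trans h)
  have hmono : Monotone fun j => classCount m (p ^ (α + 1)) (A j) := by
    refine monotone_nat_of_le_succ fun j => classCount_le (pow_pos hp.pos _) ?_ T ?_ hinj
    · intro r r' hrr h
      have h1 := dvd_add (hper _ _ _ hrr) (by exact_mod_cast h)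
      rw [sub_add_sub_cancel] at h1
      simp only [hA]
      exact_mod_cast h1
    · intro r hr
      have h1 := dvd_add (hfT r (hAX j r hr)) hr
      have h2 : f (T r) - (f r + (p : ℤ) ^ α) + (f r - j * (p : ℤ) ^ α) =
        f (T r) - ((j + 1 : ℕ) : ℤ) * (p : ℤ) ^ α := by push_cast; ring
      rwa [h2] at h1
  have hA0 : A 0 = fun r => (p : ℤ) ^ (α + 1) ∣ f r := by
    funext r
    simp [hA]
  have hAp : A p = A 0 := by
    rw [hA0]
    funext r
    simp only [hA]
    rw [← pow_succ', dvd_sub_self_right]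
  have hconst : ∀ j ∈ range p,
      classCount m (p ^ (α + 1)) (A j) = classCount m (p ^ (α + 1)) (A 0) := fun j hj =>
    le_antisymm ((hmono (mem_range.1 hj).le).trans_eq (by simp only [hAp])) (hmono (Nat.zero_le j))
  have hpα : (p : ℤ) ^ α ≠ 0 := pow_ne_zero _ (by exact_mod_cast hp.ne_zero)
  have hA' : ∀ (c : ℤ) (r : Fin m → ℤ), f r = (p : ℤ) ^ α * c →
      ∀ j : ℕ, A j r ↔ (j : ℤ) ≡ c [ZMOD p] := fun c r hc j => by
    rw [Int.modEq_iff_dvd]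
    simp only [hA]
    rw [hc, mul_comm (j : ℤ), ← mul_sub, pow_succ]
    exact mul_dvd_mul_iff_left hpα
  rw [classCount_eq_sum (P := fun r => (p : ℤ) ^ α ∣ f r) (k := p) (A := A),
    Finset.sum_congr rfl hconst, hA0]
  · simp
  · intro r
    constructor
    · rintro ⟨c, hc⟩
      have hp0 : (p : ℤ) ≠ 0 := by exact_mod_cast hp.ne_zero
      have hnn : ((c % p).toNat : ℤ) = c % p := Int.toNat_of_nonneg (Int.emod_nonneg _ hp0)
      have hlt := Int.emod_lt_of_pos c (by exact_mod_cast hp.pos : (0 : ℤ) < p)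
      exact ⟨(c % p).toNat, by omega, (hA' c r hc _).2 (by rw [hnn]; exact Int.mod_modEq _ _)⟩
    · rintro ⟨j, _, hj⟩
      exact hAX j r hj
  · intro r j hj j' hj' hjr hjr'
    obtain ⟨c, hc⟩ := hAX j r hjr
    have h1 := ((hA' c r hc j).1 hjr).trans ((hA' c r hc j').1 hjr').symm
    exact Nat.ModEq.eq_of_lt_of_lt (Int.natCast_modEq_iff.1 h1) hj hj'

lemma even_dotProduct_mulVec {S : Matrix (Fin m) (Fin m) ℤ} (hS : S.IsSymm)
    (hd : ∀ i, 2 ∣ S i i) (x : Fin m → ℤ) : 2 ∣ x ⬝ᵥ S.mulVec x := by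
  have h2 : (2 : ZMod 2) = 0 := rfl
  refine (ZMod.intCast_zmod_eq_zero_iff_dvd _ 2).1 ?_
  simp only [dotProduct, mulVec, Finset.mul_sum]
  rw [← Finset.sum_product', Int.cast_sum]
  refine Finset.sum_involution (fun ij _ => (ij.2, ij.1)) ?_ ?_ (by simp) (by simp)
  · rintro ⟨i, j⟩ _
    have := hS.apply i j
    simp only [this]
    push_cast
    linear_combination ((x i : ZMod 2) * (S i j * x j)) * h2
  · rintro ⟨i, j⟩ _ hne heq
    simp only [Prod.mk.injEq] at heq
    obtain ⟨rfl, -⟩ := heq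
    apply hne
    have := (ZMod.intCast_zmod_eq_zero_iff_dvd _ 2).2 (hd j)
    simp [this]

lemma bil_add_left (S : Matrix (Fin m) (Fin m) ℤ) (x y z : Fin m → ℚ) :
    bil S (x + y) z = bil S x z + bil S y z := add_dotProduct _ _ _

lemma bil_smul_left (S : Matrix (Fin m) (Fin m) ℤ) (c : ℚ) (x y : Fin m → ℚ) :
    bil S (c • x) y = c * bil S x y := smul_dotProduct _ _ _

lemma bil_comm {S : Matrix (Fin m) (Fin m) ℤ} (hS : S.IsSymm) (x y : Fin m → ℚ) :
    bil S x y = bil S y x := by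
  unfold bil
  rw [dotProduct_mulVec, ← mulVec_transpose, dotProduct_comm]
  congr 2
  ext i j
  simp [hS.apply i j]

lemma Qf_add {S : Matrix (Fin m) (Fin m) ℤ} (hS : S.IsSymm) (x y : Fin m → ℚ) :
    Qf S (x + y) = Qf S x + bil S y x + Qf S y := by
  unfold Qf
  rw [bil_add_left, bil_comm hS x, bil_comm hS y (x + y), bil_add_left, bil_add_left,
    bil_comm hS x y]
  ring

lemma Qf_smul {S : Matrix (Fin m) (Fin m) ℤ} (hS : S.IsSymm) (c : ℚ) (x : Fin m → ℚ) :
    Qf S (c • x) = c ^ 2 * Qf S x := by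
  unfold Qf
  rw [bil_smul_left, bil_comm hS x, bil_smul_left]
  ring

lemma bil_intCast (S : Matrix (Fin m) (Fin m) ℤ) (x y : Fin m → ℤ) :
    bil S (fun i => (x i : ℚ)) (fun i => (y i : ℚ)) = ((x ⬝ᵥ S.mulVec y : ℤ) : ℚ) := by
  simp [bil, dotProduct, mulVec]

lemma exists_Qf_intCast {S : Matrix (Fin m) (Fin m) ℤ} (hS : S.IsSymm)
    (hd : ∀ i, 2 ∣ S i i) (x : Fin m → ℤ) : ∃ z : ℤ, Qf S (fun i => (x i : ℚ)) = z := by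
  obtain ⟨z, hz⟩ := even_dotProduct_mulVec hS hd x
  refine ⟨z, ?_⟩
  rw [Qf, bil_intCast, hz]
  push_cast
  ring

/-- Siegel: for `α > 1 + 2·ν_p(2N_γn)` one has
`N_{γ,n}(p^{α+1}) = p^{m−1}·N_{γ,n}(p^α)`. -/
theorem repNum_stable (m : ℕ) (hm : 1 ≤ m) (S : Matrix (Fin m) (Fin m) ℤ)
    (hSsymm : S.IsSymm) (hSeven : ∀ i, 2 ∣ S i i) (hSdet : S.det ≠ 0)
    (γ : Fin m → ℚ) (hγ : memDual S γ) (n : ℚ) (hn : ∃ z : ℤ, n + Qf S γ = z)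
    (hn0 : n ≠ 0) (Nγ : ℕ) (hNγ : isOrderOf γ Nγ)
    (p : ℕ) (hp : p.Prime)
    (t : ℤ) (ht : (t : ℚ) = 2 * Nγ * n)
    (α : ℕ) (hα : 1 + 2 * padicValInt p t < α) :
    repNum S γ n (p ^ (α + 1)) = p ^ (m - 1) * repNum S γ n (p ^ α) := by
  obtain ⟨hN0, hNint, -⟩ := hNγ
  obtain ⟨z₀, hz₀⟩ := hn
  have hsγ : ∀ i, ∃ z : ℤ, (S.map (Int.cast : ℤ → ℚ)).mulVec γ i = z := fun i => by
    obtain ⟨z, hz⟩ := hγ (Pi.single i 1)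
    refine ⟨z, ?_⟩
    rw [bil_comm hSsymm] at hz
    rw [← hz, bil]
    have : (fun j => ((Pi.single i 1 : Fin m → ℤ) j : ℚ)) = Pi.single i 1 := by
      funext j
      simp [Pi.single_apply]
    rw [this, single_one_dotProduct]
  choose s hs using hsγ
  choose w hw using hNint
  choose q hq using exists_Qf_intCast hSsymm hSeven
  have hbil : ∀ h : Fin m → ℤ, bil S (fun i => (h i : ℚ)) γ = ((h ⬝ᵥ s : ℤ) : ℚ) := fun h => by
    rw [bil, funext hs]
    simp [dotProduct]
  set f : (Fin m → ℤ) → ℤ := fun r => q r - r ⬝ᵥ s + z₀ with hfdef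
  set g : (Fin m → ℤ) → Fin m → ℤ := fun r => S.mulVec r - s with hgdef
  have hfQ : ∀ r : Fin m → ℤ, Qf S ((fun i => (r i : ℚ)) - γ) + n = f r := fun r => by
    have h1 := Qf_add hSsymm (fun i => (r i : ℚ)) ((-1 : ℚ) • γ)
    rw [Qf_smul hSsymm, bil_smul_left, bil_comm hSsymm γ, hbil, hq, neg_one_smul,
      ← sub_eq_add_neg] at h1
    rw [h1, hfdef]
    push_cast
    linear_combination hz₀
  have hqadd : ∀ r h : Fin m → ℤ, q (r + h) = q r + h ⬝ᵥ S.mulVec r + q h := fun r h => by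
    have h1 := Qf_add hSsymm (fun i => (r i : ℚ)) (fun i => (h i : ℚ))
    have h2 := hq (r + h)
    rw [show (fun i => (((r + h) i : ℤ) : ℚ)) = (fun i => (r i : ℚ)) + fun i => (h i : ℚ) by
      funext i; simp, h1, hq, hq, bil_intCast] at h2
    exact_mod_cast h2.symm
  have hqsmul : ∀ (c : ℤ) (h : Fin m → ℤ), q (c • h) = c ^ 2 * q h := fun c h => by
    have h1 := Qf_smul hSsymm c (fun i => (h i : ℚ))
    have h2 := hq (c • h)
    rw [show (fun i => (((c • h) i : ℤ) : ℚ)) = (c : ℚ) • fun i => (h i : ℚ) by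
      funext i; simp, h1, hq] at h2
    exact_mod_cast h2.symm
  have hfadd : ∀ r h, f (r + h) = f r + h ⬝ᵥ g r + q h := fun r h => by
    simp only [hfdef, hgdef, hqadd, add_dotProduct, dotProduct_sub]
    ring
  have hgadd : ∀ r h, g (r + h) = g r + S.mulVec h := fun r h => by
    simp only [hgdef, mulVec_add]
    abel
  have hper : ∀ (a : ℤ) (r r' : Fin m → ℤ), (∀ i, a ∣ r' i - r i) → a ∣ f r' - f r := by
    intro a r r' h
    choose d hd using h
    have : r' = r + a • d := by
      funext i
      simp [← hd i]
    rw [this, hfadd, hqsmul, smul_dotProduct, smul_eq_mul]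
    exact ⟨d ⬝ᵥ g r + a * q d, by ring⟩
  have hNf : ∀ r, 2 * Nγ * f r = ((Nγ : ℤ) • r - w) ⬝ᵥ g r + t := fun r => by
    have h0 : ((((Nγ : ℤ) • r - w) ⬝ᵥ g r : ℤ) : ℚ) =
        Nγ * bil S ((fun i => (r i : ℚ)) - γ) ((fun i => (r i : ℚ)) - γ) := by
      rw [← bil_smul_left, bil, mulVec_sub, funext hs]
      have h1 : (Nγ : ℚ) • ((fun i => (r i : ℚ)) - γ) =
          fun i => ((((Nγ : ℤ) • r - w) i : ℤ) : ℚ) := by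
        funext i
        simp [mul_sub, hw]
      rw [h1]
      simp [dotProduct, mulVec, hgdef]
    have h2 := hfQ r
    rw [Qf] at h2
    have h3 : ((2 * Nγ * f r : ℤ) : ℚ) = ((((Nγ : ℤ) • r - w) ⬝ᵥ g r + t : ℤ) : ℚ) := by
      rw [Int.cast_add, h0, ht]
      push_cast
      rw [← h2]
      ring
    exact_mod_cast h3
  have ht0 : t ≠ 0 := by
    intro h
    rw [h, Int.cast_zero] at ht
    have : (Nγ : ℚ) ≠ 0 := by exact_mod_cast hN0.ne'
    simp_all
  have hnd : ∀ r, (p : ℤ) ^ α ∣ f r → ¬ ∀ i, (p : ℤ) ^ (padicValInt p t + 1) ∣ g r i := by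
    intro r hr hall
    have h1 : (p : ℤ) ^ (padicValInt p t + 1) ∣ ((Nγ : ℤ) • r - w) ⬝ᵥ g r :=
      Finset.dvd_sum fun i _ => Dvd.dvd.mul_left (hall i) _
    have h2 : (p : ℤ) ^ (padicValInt p t + 1) ∣ 2 * Nγ * f r :=
      Dvd.dvd.mul_left ((pow_dvd_pow _ (by omega)).trans hr) _
    rw [hNf, dvd_add_right h1] at h2
    have := Fact.mk hp
    rcases (padicValInt_dvd_iff _ _).1 h2 with h | h
    · exact ht0 h
    · omega
  have hrep : ∀ k : ℕ, repNum S γ n (p ^ k) =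
      classCount m (p ^ k) (fun r => (p : ℤ) ^ k ∣ f r) := fun k => by
    unfold repNum classCount
    refine Nat.card_congr (Equiv.subtypeEquivRight fun r => ?_)
    have := hfQ fun i => ((r i : ℕ) : ℤ)
    simp only [Int.cast_natCast] at this
    rw [this]
    refine exists_congr fun c => ?_
    norm_cast
  have hpows := classCount_mul (m := m) (a := p ^ α) (b := p) (P := fun r => (p : ℤ) ^ α ∣ f r)
    (fun r r' h hr => (dvd_iff_dvd_of_dvd_sub (hper _ _ _ (by exact_mod_cast h))).2 hr)
  have hmain := classCount_dvd_mul_prime hp (by omega) hfadd hqsmul hgadd hnd hper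
  rw [← pow_succ'] at hpows
  rw [hrep, hrep]
  apply Nat.eq_of_mul_eq_mul_left hp.pos
  rw [hmain, hpows, ← mul_assoc, ← pow_succ', Nat.sub_add_cancel hm]

end EisensteinWeil
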